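/- arXiv:math/0503241 — 6 statements merged into one kernel-verified Lean document; each statement's English description precedes it below -/
import Mathlib

section
/- limsup_{k→∞} n(2,k)/k² ≤ 0.4789. -/
/-- `nAdd k` is `n(2,k)`: the largest integer `n` for which there exists a set `A` of `k`
nonnegative integers such that `{0, 1, ..., n-1} ⊆ 2A = {a + a' : a, a' ∈ A}`. -/
noncomputable def nAdd (k : ℕ) : ℕ :=
  sSup {n : ℕ | ∃ A : Finset ℕ, A.card = k ∧ ∀ m < n, ∃ a ∈ A, ∃ b ∈ A, a + b = m}

open Finset in
/-- If the finite set `A` represents every `m < n` as a sum of two elements, the sum over ordered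
pairs (diagonal counted twice) of a function of `a + b` exceeds `2 ∑_{m < n} F m` by a
nonnegatively weighted sum. -/
lemma exists_excess_weight (A : Finset ℕ) (n : ℕ)
    (hA : ∀ m < n, ∃ a ∈ A, ∃ b ∈ A, a + b = m) :
    ∃ W : ℕ → ℕ → ℝ, (∀ a b, 0 ≤ W a b) ∧ (∀ a b, W a b ≤ 1 + if a = b then 1 else 0) ∧
      ∀ (E : Type) [AddCommGroup E] [Module ℝ E] (F : ℕ → E),
        ∑ a ∈ A, ∑ b ∈ A, W a b • F (a + b) =
          ∑ a ∈ A, ∑ b ∈ A, F (a + b) + ∑ a ∈ A, F (a + a) - 2 • ∑ m ∈ range n, F m := by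
  have hp : ∃ p : ℕ → ℕ, ∀ m < n, p m ∈ A ∧ p m ≤ m ∧ m - p m ∈ A := by
    refine ⟨fun m => if h : m < n then (hA m h).choose else 0, fun m h => ?_⟩
    simp only [h, dif_pos]
    obtain ⟨h1, b, hb, h2⟩ := (hA m h).choose_spec
    refine ⟨h1, by omega, ?_⟩
    have : m - (hA m h).choose = b := by omega
    rwa [this]
  obtain ⟨p, hp⟩ := hp
  let D : ℕ → ℕ → ℝ := fun a b => if a + b < n ∧ a = p (a + b) then 1 else 0
  have hD : ∀ (E : Type) [AddCommGroup E] [Module ℝ E] (F : ℕ → E),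
      ∑ a ∈ A, ∑ b ∈ A, D a b • F (a + b) = ∑ m ∈ range n, F m := by
    intro E _ _ F
    rw [← Finset.sum_product']
    simp only [D, ite_smul, one_smul, zero_smul]
    rw [← Finset.sum_filter]
    refine Finset.sum_nbij' (fun x => x.1 + x.2) (fun m => (p m, m - p m)) ?_ ?_ ?_ ?_ ?_
    · intro x hx
      simp only [mem_filter] at hx
      simpa using hx.2.1
    · intro m hm
      have hm' := mem_range.1 hm
      obtain ⟨h1, h2, h3⟩ := hp m hm'
      simp only [mem_filter, mem_product]
      have : p m + (m - p m) = m := by omega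
      refine ⟨⟨h1, h3⟩, by omega, by rw [this]⟩
    · rintro ⟨a, b⟩ hx
      simp only [mem_filter] at hx
      have := hx.2.2
      ext
      · exact this.symm
      · simp only [← this]; omega
    · intro m hm
      have := (hp m (mem_range.1 hm)).2.1
      simp only
      omega
    · intro x _; rfl
  refine ⟨fun a b => 1 + (if a = b then 1 else 0) - D a b - D b a, ?_, ?_, ?_⟩
  · intro a b
    simp only [D, add_comm b a]
    split_ifs <;> first | (exfalso; omega) | norm_num
  · intro a b
    simp only [D]
    split_ifs <;> norm_num
  · intro E _ _ F
    have hD' : ∑ a ∈ A, ∑ b ∈ A, D b a • F (a + b) = ∑ m ∈ range n, F m := by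
      rw [Finset.sum_comm, ← hD E F]
      simp only [add_comm]
    simp only [sub_smul, add_smul, one_smul, Finset.sum_sub_distrib, Finset.sum_add_distrib, hD,
      hD', ite_smul, zero_smul, Finset.sum_ite_eq]
    rw [Finset.sum_congr rfl (g := fun a => F (a + a)) (fun a ha => if_pos ha)]
    rw [two_smul]
    abel

open Finset in
lemma sum_excess_weight_le {A : Finset ℕ} {W : ℕ → ℕ → ℝ}
    (hW : ∀ a b, W a b ≤ 1 + if a = b then 1 else 0) {h : ℕ → ℝ} (hh : ∀ a, 0 ≤ h a) :
    ∑ a ∈ A, ∑ b ∈ A, W a b * (h a + h b) ≤ 2 * (#A + 1) * ∑ a ∈ A, h a := by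
  calc ∑ a ∈ A, ∑ b ∈ A, W a b * (h a + h b)
      ≤ ∑ a ∈ A, ∑ b ∈ A, (1 + if a = b then 1 else 0) * (h a + h b) :=
        sum_le_sum fun a _ => sum_le_sum fun b _ =>
          mul_le_mul_of_nonneg_right (hW a b) (add_nonneg (hh a) (hh b))
    _ = 2 * (#A + 1) * ∑ a ∈ A, h a := by
        simp only [add_mul, one_mul, ite_mul, zero_mul, sum_add_distrib, sum_ite_eq, sum_const,
          nsmul_eq_mul]
        rw [Finset.sum_congr rfl (g := fun a => h a + h a) (fun a ha => if_pos ha),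
          sum_add_distrib, ← mul_sum]
        ring

open Finset in
/-- Moser's estimate for the exponential sum over an additive basis at a nontrivial `n`-th root
of unity. -/
lemma norm_sq_sum_pow_le {A : Finset ℕ} {n : ℕ}
    (hA : ∀ m < n, ∃ a ∈ A, ∃ b ∈ A, a + b = m) {z : ℂ} (hz : z ^ n = 1) (hz1 : z ≠ 1)
    (hn : n ≠ 0) :
    ‖∑ a ∈ A, z ^ a‖ ^ 2 ≤ (#A : ℝ) ^ 2 + 2 * #A - 2 * n := by
  obtain ⟨W, hW0, -, hW⟩ := exists_excess_weight A n hA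
  have hz2 : ‖z‖ = 1 := Complex.norm_eq_one_of_pow_eq_one hz hn
  have h1 := hW ℂ (fun m => z ^ m)
  have h2 := hW ℝ (fun _ => 1)
  have h3 : ∑ m ∈ range n, z ^ m = 0 := by
    rw [geom_sum_eq hz1, hz]; simp
  have h4 : ∑ a ∈ A, ∑ b ∈ A, z ^ (a + b) = (∑ a ∈ A, z ^ a) ^ 2 := by
    rw [sq, sum_mul_sum]; simp only [pow_add]
  rw [h3, h4, smul_zero, sub_zero] at h1
  simp only [sum_const, smul_eq_mul, mul_one, nsmul_eq_mul, card_range] at h2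
  have h5 : (∑ a ∈ A, z ^ a) ^ 2 =
      ∑ a ∈ A, ∑ b ∈ A, W a b • z ^ (a + b) - ∑ a ∈ A, z ^ (a + a) := by
    rw [h1]; ring
  rw [← norm_pow, h5]
  have h6 : ‖∑ a ∈ A, ∑ b ∈ A, W a b • z ^ (a + b)‖ ≤ ∑ a ∈ A, ∑ b ∈ A, W a b := by
    refine norm_sum_le_of_le _ fun a _ => norm_sum_le_of_le _ fun b _ => ?_
    rw [norm_smul, norm_pow, hz2, one_pow, mul_one, Real.norm_of_nonneg (hW0 a b)]
  have h7 : ‖∑ a ∈ A, z ^ (a + a)‖ ≤ #A := by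
    have : ‖∑ a ∈ A, z ^ (a + a)‖ ≤ ∑ a ∈ A, (1 : ℝ) :=
      norm_sum_le_of_le _ fun a _ => by rw [norm_pow, hz2, one_pow]
    simpa using this
  refine (norm_sub_le _ _).trans ?_
  push_cast at h2
  linarith

open Finset in
lemma norm_sq_sum_exp_le {A : Finset ℕ} {n j : ℕ}
    (hA : ∀ m < n, ∃ a ∈ A, ∃ b ∈ A, a + b = m) (hj : 0 < j) (hjn : j < n) :
    (∑ a ∈ A, Real.cos (2 * Real.pi * j / n * a)) ^ 2 +
      (∑ a ∈ A, Real.sin (2 * Real.pi * j / n * a)) ^ 2 ≤ (#A : ℝ) ^ 2 + 2 * #A - 2 * n := by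
  have hn : n ≠ 0 := by omega
  have hprim := (Complex.isPrimitiveRoot_exp n hn)
  set ζ := Complex.exp (2 * Real.pi * Complex.I / n) with hζ
  have h := norm_sq_sum_pow_le hA (z := ζ ^ j)
    (by rw [← pow_mul, mul_comm, pow_mul, hprim.pow_eq_one, one_pow])
    (hprim.pow_ne_one_of_pos_of_lt hj.ne' hjn) hn
  have hza : ∀ a : ℕ, (ζ ^ j) ^ a = Real.cos (2 * Real.pi * j / n * a) +
      Real.sin (2 * Real.pi * j / n * a) * Complex.I := by
    intro a
    rw [hζ, ← Complex.exp_nat_mul, ← Complex.exp_nat_mul, Complex.ofReal_cos, Complex.ofReal_sin,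
      ← Complex.exp_mul_I]
    congr 1
    push_cast
    ring
  rw [Complex.sq_norm, Complex.normSq_apply, Complex.re_sum, Complex.im_sum] at h
  have hre : ∀ a : ℕ, ((ζ ^ j) ^ a).re = Real.cos (2 * Real.pi * j / n * a) := by
    intro a; rw [hza]; simp [-Complex.ofReal_cos, -Complex.ofReal_sin]
  have him : ∀ a : ℕ, ((ζ ^ j) ^ a).im = Real.sin (2 * Real.pi * j / n * a) := by
    intro a; rw [hza]; simp [-Complex.ofReal_cos, -Complex.ofReal_sin]
  simp only [hre, him] at h
  linarith

/-- The defect in `σ + κ ≤ 1 + σκ - 0.34 σ²κ²` on the unit circle. -/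
noncomputable def trigDefect (σ κ : ℝ) : ℝ := 1 + σ * κ - 0.34 * (σ * κ) ^ 2 - σ - κ

lemma trigDefect_nonneg {σ κ : ℝ} (h : σ ^ 2 + κ ^ 2 = 1) : 0 ≤ trigDefect σ κ := by
  have h1 : σ + κ ≤ 1.4143 := by nlinarith [sq_nonneg (σ - κ)]
  have h2 : -1.4143 ≤ σ + κ := by nlinarith [sq_nonneg (σ - κ)]
  have h3 : σ * κ = ((σ + κ) ^ 2 - 1) / 2 := by linear_combination (-1 / 2) * h
  have h4 : trigDefect σ κ = (σ + κ - 1) ^ 2 * (1 / 2 - 0.085 * (σ + κ + 1) ^ 2) := by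
    rw [trigDefect, show 1 + σ * κ - 0.34 * (σ * κ) ^ 2 - σ - κ =
      1 + σ * κ - 0.34 * (σ * κ) ^ 2 - (σ + κ) by ring, h3]
    ring
  rw [h4]
  refine mul_nonneg (sq_nonneg _) ?_
  nlinarith

lemma le_trigDefect_of_nonpos {σ κ : ℝ} (h : σ ^ 2 + κ ^ 2 = 1) (hσ : 0 ≤ σ) (hκ : κ ≤ 0) :
    0.4 * σ ^ 2 + 0.625 * κ ^ 2 ≤ 0.44 + 0.25 * trigDefect σ κ := by
  have hσ1 : σ ≤ 1 := by nlinarith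
  have h1 : κ ^ 2 / 2 ≤ 1 - σ := by nlinarith
  have h2 : (σ * κ) ^ 2 ≤ 1 / 4 := by
    rw [mul_pow]; nlinarith [sq_nonneg (σ ^ 2 - κ ^ 2)]
  have h3 : κ ^ 2 / 2 * (1 - κ) ≤ (1 - σ) * (1 - κ) :=
    mul_le_mul_of_nonneg_right h1 (by linarith)
  have h4 : 0.1 * κ ^ 2 + 0.125 * κ ^ 3 ≤ 0.01875 := by
    nlinarith [mul_nonneg (neg_nonneg.2 hκ) (sq_nonneg (κ + 0.5333)), sq_nonneg (κ + 0.5333)]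
  rw [trigDefect]
  nlinarith

lemma neg_mul_add_mul_le {σ κ σ' κ' : ℝ} (h : σ ^ 2 + κ ^ 2 = 1) (h' : σ' ^ 2 + κ' ^ 2 = 1)
    (hσ : 0 ≤ σ) (hσ' : 0 ≤ σ') :
    -(σ * κ' + κ * σ') ≤ 0.88 + 0.25 * (trigDefect σ κ + trigDefect σ' κ') := by
  have d := trigDefect_nonneg h
  have d' := trigDefect_nonneg h'
  rcases le_total κ 0 with hκ | hκ <;> rcases le_total κ' 0 with hκ' | hκ'
  · nlinarith [le_trigDefect_of_nonpos h hσ hκ, le_trigDefect_of_nonpos h' hσ' hκ',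
      sq_nonneg (0.8 * σ + κ'), sq_nonneg (0.8 * σ' + κ)]
  · nlinarith [le_trigDefect_of_nonpos h hσ hκ, sq_nonneg (0.8 * σ' + κ), mul_nonneg hσ hκ']
  · nlinarith [le_trigDefect_of_nonpos h' hσ' hκ', sq_nonneg (0.8 * σ + κ'), mul_nonneg hσ' hκ]
  · nlinarith [mul_nonneg hσ hκ', mul_nonneg hσ' hκ]

open Finset in
lemma sum_sin_mul_sin (y : ℝ) (n : ℕ) :
    2 * Real.sin y * ∑ m ∈ range n, Real.sin (2 * y * m) =
      Real.cos y - Real.cos (2 * y * n - y) := by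
  induction n with
  | zero => simp
  | succ n ih =>
    rw [sum_range_succ, mul_add, ih]
    push_cast
    rw [show 2 * y * (n + 1) - y = 2 * y * n + y by ring, Real.cos_add, Real.cos_sub]
    ring

open Finset in
lemma le_sum_sin {n : ℕ} (hn : 0 < n) :
    2 * n / Real.pi - 1 ≤ ∑ m ∈ range n, Real.sin (Real.pi / n * m) := by
  have hn' : (1 : ℝ) ≤ n := by exact_mod_cast hn
  have hpi := Real.pi_gt_three
  have hpi' := Real.pi_lt_d2
  set y := Real.pi / (2 * n) with hy
  have hy0 : 0 < y := by positivity
  have hy1 : y ≤ Real.pi / 2 := by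
    rw [hy]; gcongr; linarith
  have h := sum_sin_mul_sin y n
  have e1 : 2 * y = Real.pi / n := by rw [hy]; field_simp
  have e2 : 2 * y * n - y = Real.pi - y := by rw [e1]; field_simp
  rw [e2, Real.cos_pi_sub, e1] at h
  set T := ∑ m ∈ range n, Real.sin (Real.pi / n * m)
  have hs : 0 < Real.sin y := Real.sin_pos_of_pos_of_lt_pi hy0 (by linarith)
  have hs' : Real.sin y ≤ y := Real.sin_le hy0.le
  have hT : Real.sin y * T = Real.cos y := by linarith
  have hc : 1 - y ^ 2 / 2 ≤ Real.cos y := Real.one_sub_sq_div_two_le_cos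
  have hc0 : 0 ≤ Real.cos y := Real.cos_nonneg_of_neg_pi_div_two_le_of_le (by linarith) hy1
  have hT0 : 0 ≤ T := by
    by_contra! hneg
    nlinarith
  have e3 : 2 * n / Real.pi = 1 / y := by rw [hy]; field_simp
  rw [e3, sub_le_iff_le_add, div_le_iff₀ hy0]
  have : Real.sin y * T ≤ y * T := mul_le_mul_of_nonneg_right hs' hT0
  nlinarith

set_option maxHeartbeats 1000000 in
open Finset in
/-- Quantitative form: a large `k`-element basis for `[0, n)` inside `[0, n)` has
`n ≤ 0.4789 k²`. -/
lemma le_of_basis {A : Finset ℕ} {n : ℕ} (hk : 1000000 ≤ #A) (hlt : ∀ a ∈ A, a < n)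
    (hA : ∀ m < n, ∃ a ∈ A, ∃ b ∈ A, a + b = m) : (n : ℝ) ≤ 0.4789 * (#A : ℝ) ^ 2 := by
  by_contra! hlarge
  obtain ⟨k, hkA⟩ : ∃ k : ℝ, k = #A := ⟨_, rfl⟩
  have hk' : (1000000 : ℝ) ≤ k := by rw [hkA]; exact_mod_cast hk
  have hn2 : 2 < n := by
    have : (2 : ℝ) < n := by rw [← hkA] at hlarge; nlinarith
    exact_mod_cast this
  have hn0 : (0 : ℝ) < n := by exact_mod_cast (by omega : 0 < n)
  have m1 := norm_sq_sum_exp_le hA (j := 1) one_pos (by omega)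
  have m2 := norm_sq_sum_exp_le hA (j := 2) two_pos hn2
  obtain ⟨W, hW0, hW1, hW⟩ := exists_excess_weight A n hA
  rw [← hkA] at m1 m2 hlarge
  set σ : ℕ → ℝ := fun a => Real.sin (Real.pi / n * a) with hσ
  set κ : ℕ → ℝ := fun a => Real.cos (Real.pi / n * a) with hκ
  have hcirc : ∀ a, σ a ^ 2 + κ a ^ 2 = 1 := fun a => Real.sin_sq_add_cos_sq _
  have hσ0 : ∀ a ∈ A, 0 ≤ σ a := fun a ha => by
    refine Real.sin_nonneg_of_nonneg_of_le_pi (by positivity) ?_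
    have : (a : ℝ) ≤ n := by exact_mod_cast (hlt a ha).le
    rw [div_mul_eq_mul_div, div_le_iff₀ hn0]
    gcongr
  have e1 : ∀ a : ℕ, Real.sin (2 * Real.pi * (1 : ℕ) / n * a) = 2 * (σ a * κ a) := fun a => by
    rw [show 2 * Real.pi * (1 : ℕ) / n * a = 2 * (Real.pi / n * a) by push_cast; ring,
      Real.sin_two_mul]
    ring
  have e2 : ∀ a : ℕ, Real.cos (2 * Real.pi * (2 : ℕ) / n * a) = 1 - 8 * (σ a * κ a) ^ 2 :=
    fun a => by
    rw [show 2 * Real.pi * (2 : ℕ) / n * a = 2 * (2 * (Real.pi / n * a)) by push_cast; ring,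
      Real.cos_two_mul, Real.cos_sq', Real.sin_two_mul]
    ring
  have e3 : ∀ a b : ℕ, Real.sin (Real.pi / n * (a + b : ℕ)) = σ a * κ b + κ a * σ b :=
    fun a b => by
    rw [Nat.cast_add, mul_add, Real.sin_add]
  simp only [e1] at m1
  simp only [e2] at m2
  set h : ℕ → ℝ := fun a => trigDefect (σ a) (κ a) with hh
  have hh0 : ∀ a, 0 ≤ h a := fun a => trigDefect_nonneg (hcirc a)
  set P := ∑ a ∈ A, σ a * κ a with hP
  set Q := ∑ a ∈ A, (σ a * κ a) ^ 2 with hQ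
  set S := ∑ a ∈ A, σ a with hS
  set C := ∑ a ∈ A, κ a with hC
  set H := ∑ a ∈ A, h a with hH
  have hS0 : 0 ≤ S := sum_nonneg hσ0
  have hH0 : 0 ≤ H := sum_nonneg fun a _ => hh0 a
  have hHeq : H = k + P - 0.34 * Q - S - C := by
    simp only [hH, hh, trigDefect, sum_sub_distrib, sum_add_distrib, ← mul_sum, hP, hQ, hS, hC,
      sum_const, nsmul_eq_mul, mul_one, hkA]
  have p1 : 2 * P ≤ 0.206 * k := by
    rw [← mul_sum] at m1
    refine abs_le_of_sq_le_sq' ?_ (by positivity) |>.2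
    nlinarith [sq_nonneg (∑ a ∈ A, Real.cos (2 * Real.pi * (1 : ℕ) / n * a))]
  have p2 : k - 8 * Q ≤ 0.206 * k := by
    rw [sum_sub_distrib, ← mul_sum, sum_const, nsmul_eq_mul, mul_one, ← hkA] at m2
    refine abs_le_of_sq_le_sq' ?_ (by positivity) |>.2
    nlinarith [sq_nonneg (∑ a ∈ A, Real.sin (2 * Real.pi * (2 : ℕ) / n * a))]
  have w1 := hW ℝ (fun _ => 1)
  simp only [sum_const, smul_eq_mul, mul_one, nsmul_eq_mul, card_range, ← hkA] at w1
  push_cast at w1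
  have w2 := hW ℝ (fun m => Real.sin (Real.pi / n * m))
  simp only [e3, smul_eq_mul, nsmul_eq_mul] at w2
  have w3 : ∑ a ∈ A, ∑ b ∈ A, (σ a * κ b + κ a * σ b) = 2 * (S * C) := by
    simp only [sum_add_distrib, ← sum_mul_sum, ← hS, ← hC]
    ring
  have w4 : ∑ a ∈ A, (σ a * κ a + κ a * σ a) = 2 * P := by
    rw [hP, mul_sum]
    exact sum_congr rfl fun a _ => by ring
  rw [w3, w4] at w2
  have hsum := le_sum_sin (n := n) (by omega)
  have hpi : 0.6366 * (n : ℝ) ≤ 2 * n / Real.pi := by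
    rw [le_div_iff₀ Real.pi_pos]
    nlinarith [Real.pi_lt_d4]
  have b1 : -(∑ a ∈ A, ∑ b ∈ A, W a b) ≤
      ∑ a ∈ A, ∑ b ∈ A, W a b * (σ a * κ b + κ a * σ b) := by
    simp only [← sum_neg_distrib]
    refine sum_le_sum fun a _ => sum_le_sum fun b _ => ?_
    rw [← e3]
    nlinarith [hW0 a b, Real.neg_one_le_sin (Real.pi / n * (a + b : ℕ))]
  have b2 : -(0.88 * ∑ a ∈ A, ∑ b ∈ A, W a b) -
        0.25 * ∑ a ∈ A, ∑ b ∈ A, W a b * (h a + h b) ≤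
      ∑ a ∈ A, ∑ b ∈ A, W a b * (σ a * κ b + κ a * σ b) := by
    simp only [← sum_neg_distrib, mul_sum, ← sum_sub_distrib]
    refine sum_le_sum fun a ha => sum_le_sum fun b hb => ?_
    have := neg_mul_add_mul_le (hcirc a) (hcirc b) (hσ0 a ha) (hσ0 b hb)
    have := mul_le_mul_of_nonneg_left this (hW0 a b)
    simp only [hh]
    linarith
  have b3 := sum_excess_weight_le (A := A) hW1 hh0
  rw [← hkA, ← hH] at b3
  have hk2 : 1000000 * k ≤ k ^ 2 := by nlinarith
  have hSC : 0 < S * C := by linarith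
  have hC0 : 0 < C := by
    by_contra! hneg
    exact hSC.not_ge (mul_nonpos_of_nonneg_of_nonpos hS0 hneg)
  have hB : S + C ≤ 1.06926 * k - H := by linarith
  have hsq : (S + C) ^ 2 ≤ (1.06926 * k - H) ^ 2 := by gcongr
  have hHle : H * H ≤ 1.06926 * k * H := mul_le_mul_of_nonneg_right (by linarith) hH0
  have hamgm : 4 * (S * C) ≤ (S + C) ^ 2 := by nlinarith [sq_nonneg (S - C)]
  have hkH : 1000000 * H ≤ k * H := mul_le_mul_of_nonneg_right hk' hH0
  linarith

open Finset in
lemma nAdd_le {k : ℕ} (hk : 1000000 ≤ k) : (nAdd k : ℝ) ≤ 0.4789 * (k : ℝ) ^ 2 := by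
  have hk' : (1000000 : ℝ) ≤ k := by exact_mod_cast hk
  refine (Nat.cast_le.2 (csSup_le' ?_)).trans (Nat.floor_le (by positivity))
  rintro n ⟨A, hcard, hA⟩
  refine Nat.le_floor ?_
  rcases le_or_gt n k with hnk | hnk
  · have : (n : ℝ) ≤ k := by exact_mod_cast hnk
    nlinarith
  · obtain ⟨B, hAB, hBn, hB⟩ := exists_subsuperset_card_eq
      (s := A.filter (· < n)) (t := range n) (n := k)
      (fun a ha => mem_range.2 (mem_filter.1 ha).2)
      (hcard ▸ card_filter_le _ _) (by simpa using hnk.le)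
    have h := le_of_basis (A := B) (n := n) (hB ▸ hk) (fun a ha => mem_range.1 (hBn ha)) (by
      intro m hm
      obtain ⟨a, ha, b, hb, hab⟩ := hA m hm
      exact ⟨a, hAB (mem_filter.2 ⟨ha, by omega⟩), b, hAB (mem_filter.2 ⟨hb, by omega⟩), hab⟩)
    rwa [hB] at h

theorem limsup_nAdd_le :
    Filter.limsup (fun k : ℕ => (nAdd k : ℝ) / (k : ℝ) ^ 2) Filter.atTop ≤ 0.4789 := by
  refine Filter.limsup_le_of_le ?_ ?_
  · exact Filter.isCoboundedUnder_le_of_le Filter.atTop (x := 0) fun k => by positivity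
  · filter_upwards [Filter.eventually_ge_atTop 1000000] with k hk
    have hk' : (0 : ℝ) < k := by exact_mod_cast (by omega : 0 < k)
    rw [div_le_iff₀ (by positivity)]
    exact nAdd_le hk
end

section
/- Let k ≥ 2 and let A be an extremal k-basis of order 2, i.e., A is a set of at most k nonnegative integers with n(2,A) = n(2,k), where n(2,A) = max{n : {0,...,n−1} ⊆ 2A}. Then, writing n = n(2,k), we have {0, 1} ⊆ A ⊆ {0, 1, 2, ..., n−1} ⊆ 2A. -/
/-- `nA A` is `n(2,A) = max {n : {0,1,...,n-1} ⊆ 2A}`. -/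
noncomputable def nA (A : Finset ℕ) : ℕ :=
  sSup {n : ℕ | ∀ m < n, ∃ a ∈ A, ∃ b ∈ A, a + b = m}

/-- A set whose pairwise sums cover `{0, ..., n-1}` has at least `√n` elements. -/
lemma le_card_mul_card_of_covers {A : Finset ℕ} {n : ℕ}
    (h : ∀ m < n, ∃ a ∈ A, ∃ b ∈ A, a + b = m) : n ≤ A.card * A.card := by
  have hsub : Finset.range n ⊆ (A ×ˢ A).image (fun p => p.1 + p.2) := by
    intro m hm
    obtain ⟨a, ha, b, hb, hab⟩ := h m (Finset.mem_range.mp hm)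
    exact Finset.mem_image.mpr ⟨(a, b), Finset.mk_mem_product ha hb, hab⟩
  simpa using (Finset.card_le_card hsub).trans Finset.card_image_le

lemma covers_nA (A : Finset ℕ) : ∀ m < nA A, ∃ a ∈ A, ∃ b ∈ A, a + b = m :=
  Nat.sSup_mem (s := {n : ℕ | ∀ m < n, ∃ a ∈ A, ∃ b ∈ A, a + b = m})
    ⟨0, fun _ hm => absurd hm (Nat.not_lt_zero _)⟩
    ⟨A.card * A.card, fun _ h => le_card_mul_card_of_covers h⟩

lemma le_nAdd_of_covers {k n : ℕ} {A : Finset ℕ} (hcard : A.card ≤ k)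
    (h : ∀ m < n, ∃ a ∈ A, ∃ b ∈ A, a + b = m) : n ≤ nAdd k := by
  obtain ⟨B, hAB, hB⟩ := Infinite.exists_superset_card_eq A k hcard
  refine le_csSup ⟨k * k, ?_⟩ ⟨B, hB, fun m hm => ?_⟩
  · rintro _ ⟨C, rfl, hC⟩
    exact le_card_mul_card_of_covers hC
  · obtain ⟨a, ha, b, hb, hab⟩ := h m hm
    exact ⟨a, hAB ha, b, hAB hb, hab⟩

lemma three_le_nAdd {k : ℕ} (hk : 2 ≤ k) : 3 ≤ nAdd k :=
  le_nAdd_of_covers (A := {0, 1}) (by simpa using hk) (by decide)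

theorem extremal_basis_structure (k : ℕ) (hk : 2 ≤ k) (A : Finset ℕ)
    (hcard : A.card ≤ k) (hext : nA A = nAdd k) :
    0 ∈ A ∧ 1 ∈ A ∧ (∀ a ∈ A, a < nAdd k) ∧
      ∀ m < nAdd k, ∃ a ∈ A, ∃ b ∈ A, a + b = m := by
  have hcov := hext ▸ covers_nA A
  have hn := three_le_nAdd hk
  have h0 : 0 ∈ A := by
    obtain ⟨a, ha, b, hb, hab⟩ := hcov 0 (by omega)
    obtain rfl : a = 0 := by omega
    exact ha
  have h1 : 1 ∈ A := by
    obtain ⟨a, ha, b, hb, hab⟩ := hcov 1 (by omega)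
    rcases (by omega : a = 1 ∨ b = 1) with rfl | rfl <;> assumption
  refine ⟨h0, h1, fun x hx => ?_, hcov⟩
  by_contra! hxn
  -- Replacing `x` by `nAdd k` keeps all sums below `nAdd k` and adds the sum `0 + nAdd k`.
  have hle : nAdd k + 1 ≤ nAdd k := by
    refine le_nAdd_of_covers (A := insert (nAdd k) (A.erase x)) ?_ fun m hm => ?_
    · have := Finset.card_insert_le (nAdd k) (A.erase x)
      have := Finset.card_erase_add_one hx
      omega
    · rcases Nat.lt_succ_iff_lt_or_eq.mp hm with hm | rfl
      · obtain ⟨a, ha, b, hb, hab⟩ := hcov m hm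
        exact ⟨a, Finset.mem_insert_of_mem (Finset.mem_erase.mpr ⟨by omega, ha⟩),
          b, Finset.mem_insert_of_mem (Finset.mem_erase.mpr ⟨by omega, hb⟩), hab⟩
      · exact ⟨0, Finset.mem_insert_of_mem (Finset.mem_erase.mpr ⟨by omega, h0⟩),
          nAdd k, Finset.mem_insert_self _ _, zero_add _⟩
  omega
end

section
/- For every positive integer k, n(2,k) ≤ (1/2 − 1/98)k² + k = (24/49)k² + k. -/
open Finset in
/-- The number of ordered representations of `m` as a sum of two elements of `A`, with the
diagonal representation counted twice. -/
def repWeight (A : Finset ℕ) (m : ℕ) : ℕ :=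
  #{p ∈ A ×ˢ A | p.1 + p.2 = m} + #{a ∈ A | 2 * a = m}

open Finset in
theorem two_le_repWeight {A : Finset ℕ} {m : ℕ} (h : ∃ a ∈ A, ∃ b ∈ A, a + b = m) :
    2 ≤ repWeight A m := by
  obtain ⟨a, ha, b, hb, rfl⟩ := h
  unfold repWeight
  rcases eq_or_ne a b with rfl | hab
  · have h₁ : 0 < #{p ∈ A ×ˢ A | p.1 + p.2 = a + a} :=
      card_pos.2 ⟨(a, a), by simp [ha]⟩
    have h₂ : 0 < #{x ∈ A | 2 * x = a + a} :=
      card_pos.2 ⟨a, by simp [ha, two_mul]⟩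
    omega
  · have h₁ : 1 < #{p ∈ A ×ˢ A | p.1 + p.2 = a + b} :=
      one_lt_card.2 ⟨(a, b), by simp [ha, hb], (b, a), by simp [ha, hb, add_comm],
        by simp [hab]⟩
    omega

open Finset in
theorem sum_repWeight_mul {R : Type*} [CommSemiring R] {A : Finset ℕ} {n : ℕ}
    (hA : ∀ a ∈ A, a < n) (F : ℕ → R) :
    ∑ m ∈ range (2 * n), (repWeight A m : R) * F m =
      ∑ a ∈ A, ∑ b ∈ A, F (a + b) + ∑ a ∈ A, F (2 * a) := by
  rw [← sum_product' A A fun a b => F (a + b),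
    ← sum_fiberwise_of_maps_to (s := A ×ˢ A) (t := range (2 * n)) (g := fun p => p.1 + p.2),
    ← sum_fiberwise_of_maps_to (s := A) (t := range (2 * n)) (g := fun a => 2 * a),
    ← sum_add_distrib]
  · refine sum_congr rfl fun m _ => ?_
    have h₁ : ∑ p ∈ A ×ˢ A with p.1 + p.2 = m, F (p.1 + p.2) =
        #{p ∈ A ×ˢ A | p.1 + p.2 = m} * F m := by
      rw [sum_congr rfl fun p hp => by rw [(mem_filter.1 hp).2], sum_const, nsmul_eq_mul]
    have h₂ : ∑ a ∈ A with 2 * a = m, F (2 * a) = #{a ∈ A | 2 * a = m} * F m := by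
      rw [sum_congr rfl fun p hp => by rw [(mem_filter.1 hp).2], sum_const, nsmul_eq_mul]
    rw [h₁, h₂, repWeight]
    push_cast
    ring
  · intro a ha
    have := hA a ha
    simp only [mem_range]
    omega
  · intro p hp
    have h₁ := hA _ (mem_product.1 hp).1
    have h₂ := hA _ (mem_product.1 hp).2
    simp only [mem_range]
    omega

open Finset in
theorem sum_repWeight {A : Finset ℕ} {n : ℕ} (hA : ∀ a ∈ A, a < n) :
    ∑ m ∈ range (2 * n), repWeight A m = #A ^ 2 + #A := by
  simpa [sq] using sum_repWeight_mul hA fun _ => (1 : ℕ)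

open Finset in
/-- Elements in the upper half of `[0, n)` only produce sums that are at least `n`. -/
theorem sq_card_upper_half_add_le {A : Finset ℕ} {n : ℕ} (hA : ∀ a ∈ A, a < n)
    (h : ∀ m < n, ∃ a ∈ A, ∃ b ∈ A, a + b = m) :
    #{a ∈ A | n ≤ 2 * a} ^ 2 + 2 * n ≤ #A ^ 2 + #A := by
  have h_low : 2 * n ≤ ∑ m ∈ range (2 * n), repWeight A m * (if m < n then 1 else 0) := by
    calc 2 * n = ∑ m ∈ range n, 2 := by simp [mul_comm]
      _ ≤ ∑ m ∈ range n, repWeight A m * (if m < n then 1 else 0) :=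
        sum_le_sum fun m hm => by
          simpa [mem_range.1 hm] using two_le_repWeight (h m (mem_range.1 hm))
      _ ≤ _ := sum_le_sum_of_subset (range_subset_range.2 (by omega))
  have h_high : #{a ∈ A | n ≤ 2 * a} ^ 2 ≤
      ∑ m ∈ range (2 * n), repWeight A m * (if m < n then 0 else 1) := by
    have := sum_repWeight_mul hA fun m => if m < n then 0 else 1
    simp only [Nat.cast_id] at this
    rw [this]
    refine le_trans ?_ (Nat.le_add_right _ _)
    set U := A.filter fun a => n ≤ 2 * a
    calc #U ^ 2 = ∑ a ∈ U, ∑ b ∈ U, 1 := by simp [sq]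
      _ = ∑ a ∈ U, ∑ b ∈ U, if a + b < n then 0 else 1 :=
        sum_congr rfl fun a ha => sum_congr rfl fun b hb => by
          have h₁ := (mem_filter.1 ha).2
          have h₂ := (mem_filter.1 hb).2
          rw [if_neg (by omega)]
      _ ≤ ∑ a ∈ U, ∑ b ∈ A, if a + b < n then 0 else 1 :=
        sum_le_sum fun a _ => sum_le_sum_of_subset (filter_subset _ _)
      _ ≤ _ := sum_le_sum_of_subset (filter_subset _ _)
  have h_sum : ∑ m ∈ range (2 * n), repWeight A m * (if m < n then 1 else 0) +
      ∑ m ∈ range (2 * n), repWeight A m * (if m < n then 0 else 1) = #A ^ 2 + #A := by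
    rw [← sum_add_distrib, ← sum_repWeight hA]
    exact sum_congr rfl fun m _ => by split_ifs <;> simp
  omega

open Finset in
/-- The exponential sum over a basis of `[0, n)` is small at nontrivial `n`-th roots of unity. -/
theorem norm_sum_pow_sq_le {A : Finset ℕ} {n : ℕ} (hA : ∀ a ∈ A, a < n)
    (h : ∀ m < n, ∃ a ∈ A, ∃ b ∈ A, a + b = m) {z : ℂ} (hz : z ^ n = 1) (hz1 : z ≠ 1)
    (hnorm : ‖z‖ = 1) :
    ‖∑ a ∈ A, z ^ a‖ ^ 2 ≤ (#A : ℝ) ^ 2 + 2 * #A - 2 * n := by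
  have h_geom : ∑ m ∈ range n, z ^ m = 0 := by rw [geom_sum_eq hz1, hz]; simp
  have h_filter : {m ∈ range (2 * n) | m < n} = range n := by ext m; simp; omega
  have h_ind : ∑ m ∈ range (2 * n), (if m < n then 2 * z ^ m else 0) = 0 := by
    rw [← sum_filter, h_filter, ← mul_sum, h_geom, mul_zero]
  have h_ind_card : ∑ m ∈ range (2 * n), (if m < n then (2 : ℝ) else 0) = 2 * n := by
    rw [← sum_filter, h_filter]
    simp [mul_comm]
  have h_eq : (∑ a ∈ A, z ^ a) ^ 2 =
      ∑ m ∈ range (2 * n), ((repWeight A m : ℂ) - if m < n then 2 else 0) * z ^ m -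
        ∑ a ∈ A, z ^ (2 * a) := by
    have h₁ := sum_repWeight_mul hA fun m => z ^ m
    simp only [sub_mul, sum_sub_distrib, ite_mul, zero_mul, h_ind, h₁]
    rw [sq, sum_mul_sum]
    simp [pow_add]
  have h_total : ∑ m ∈ range (2 * n), (repWeight A m : ℝ) = (#A : ℝ) ^ 2 + #A := by
    exact_mod_cast sum_repWeight hA
  have h_excess :
      ‖∑ m ∈ range (2 * n), ((repWeight A m : ℂ) - if m < n then 2 else 0) * z ^ m‖ ≤
        (#A : ℝ) ^ 2 + #A - 2 * n := by
    calc _ ≤ ∑ m ∈ range (2 * n), ((repWeight A m : ℝ) - if m < n then 2 else 0) := by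
          refine norm_sum_le_of_le _ fun m _ => ?_
          rw [norm_mul, norm_pow, hnorm, one_pow, mul_one]
          have h_nonneg : (0 : ℝ) ≤ (repWeight A m : ℝ) - if m < n then 2 else 0 := by
            split_ifs with hm
            · have : (2 : ℝ) ≤ repWeight A m := by exact_mod_cast two_le_repWeight (h m hm)
              linarith
            · simp
          rw [← Complex.norm_of_nonneg h_nonneg]
          apply le_of_eq
          congr 1
          split_ifs <;> simp
      _ = _ := by rw [sum_sub_distrib, h_total, h_ind_card]
  have h_diag : ‖∑ a ∈ A, z ^ (2 * a)‖ ≤ #A := by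
    calc _ ≤ ∑ a ∈ A, (1 : ℝ) := norm_sum_le_of_le _ fun a _ => by simp [hnorm]
      _ = _ := by simp
  rw [← norm_pow, h_eq]
  refine (norm_sub_le _ _).trans ?_
  linarith

open Finset in
/-- The pointwise inequality `1 - 2 sin θ - cos 2θ ≤ 4 · 𝟙[sin θ < 0]`, summed over `A`. -/
theorem card_le_four_mul_upper_half_add {A : Finset ℕ} {n : ℕ} (hn : 0 < n) :
    (#A : ℝ) ≤ 4 * #{a ∈ A | n ≤ 2 * a} +
      2 * ‖∑ a ∈ A, Complex.exp (2 * Real.pi * Complex.I / n) ^ a‖ +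
      ‖∑ a ∈ A, (Complex.exp (2 * Real.pi * Complex.I / n) ^ 2) ^ a‖ := by
  set z := Complex.exp (2 * Real.pi * Complex.I / n) with hz
  have h_pow (a : ℕ) : z ^ a = Complex.exp ((2 * Real.pi * a / n : ℝ) * Complex.I) := by
    rw [hz, ← Complex.exp_nat_mul]
    congr 1
    push_cast
    ring
  have h_point : ∀ a ∈ A, 1 - 2 * (z ^ a).im - ((z ^ 2) ^ a).re ≤
      4 * (if n ≤ 2 * a then (1 : ℝ) else 0) := by
    intro a _
    rw [← pow_mul, mul_comm 2 a, pow_mul, h_pow, sq (Complex.exp _), Complex.mul_re,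
      Complex.exp_ofReal_mul_I_re, Complex.exp_ofReal_mul_I_im]
    have h_sq := Real.sin_sq_add_cos_sq (2 * Real.pi * a / n)
    have h_neg := Real.neg_one_le_sin (2 * Real.pi * a / n)
    have h_one := Real.sin_le_one (2 * Real.pi * a / n)
    split_ifs with h
    · nlinarith
    · have h_nonneg : 0 ≤ Real.sin (2 * Real.pi * a / n) := by
        refine Real.sin_nonneg_of_nonneg_of_le_pi (by positivity) ?_
        rw [div_le_iff₀ (by positivity)]
        have : (2 * a : ℝ) ≤ n := by exact_mod_cast (by omega : 2 * a ≤ n)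
        nlinarith [Real.pi_pos]
      nlinarith
  have h_sum := sum_le_sum h_point
  simp only [sum_sub_distrib, ← mul_sum, sum_boole, sum_const, nsmul_eq_mul, mul_one,
    ← Complex.im_sum, ← Complex.re_sum] at h_sum
  have h_im := Complex.im_le_norm (∑ a ∈ A, z ^ a)
  have h_re := Complex.re_le_norm (∑ a ∈ A, (z ^ 2) ^ a)
  linarith

open Finset in
theorem basis_length_le_of_lt {A : Finset ℕ} {n : ℕ} (hn : 3 ≤ n) (hA : ∀ a ∈ A, a < n)
    (h : ∀ m < n, ∃ a ∈ A, ∃ b ∈ A, a + b = m) :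
    98 * n ≤ 48 * #A ^ 2 + 98 * #A := by
  set z := Complex.exp (2 * Real.pi * Complex.I / n) with hz
  have h_prim : IsPrimitiveRoot z n := Complex.isPrimitiveRoot_exp n (by omega)
  have h_norm : ‖z‖ = 1 := h_prim.norm'_eq_one (by omega)
  have h₁ := norm_sum_pow_sq_le hA h h_prim.pow_eq_one (h_prim.ne_one (by omega)) h_norm
  have h₂ := norm_sum_pow_sq_le hA h (z := z ^ 2)
    (by rw [← pow_mul, mul_comm, pow_mul, h_prim.pow_eq_one, one_pow])
    (h_prim.pow_ne_one_of_pos_of_lt two_ne_zero (by omega)) (by simp [h_norm])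
  have h₃ : (#{a ∈ A | n ≤ 2 * a} : ℝ) ^ 2 + 2 * n ≤ (#A : ℝ) ^ 2 + #A := by
    exact_mod_cast sq_card_upper_half_add_le hA h
  have h₄ := card_le_four_mul_upper_half_add (A := A) (n := n) (by omega)
  rw [← hz] at h₄
  set B := √((#A : ℝ) ^ 2 + 2 * #A - 2 * n)
  have hB : B ^ 2 = (#A : ℝ) ^ 2 + 2 * #A - 2 * n := Real.sq_sqrt ((sq_nonneg _).trans h₁)
  have h₅ := Real.le_sqrt_of_sq_le h₁
  have h₆ := Real.le_sqrt_of_sq_le h₂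
  have h_card : (0 : ℝ) ≤ #A := Nat.cast_nonneg _
  have h₇ : (#{a ∈ A | n ≤ 2 * a} : ℝ) ≤ B := Real.le_sqrt_of_sq_le (by linarith)
  have h₈ : (#A : ℝ) ≤ 7 * B := by linarith
  have h₉ : (#A : ℝ) ^ 2 ≤ (7 * B) ^ 2 := pow_le_pow_left₀ h_card h₈ 2
  have : (98 * n : ℝ) ≤ 48 * (#A : ℝ) ^ 2 + 98 * #A := by nlinarith
  exact_mod_cast this

open Finset in
theorem basis_length_le {A : Finset ℕ} {n : ℕ} (h_pos : 0 < #A)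
    (h : ∀ m < n, ∃ a ∈ A, ∃ b ∈ A, a + b = m) :
    98 * n ≤ 48 * #A ^ 2 + 98 * #A := by
  set A' := A.filter (· < n)
  have hA' : ∀ a ∈ A', a < n := fun a ha => (mem_filter.1 ha).2
  have h' : ∀ m < n, ∃ a ∈ A', ∃ b ∈ A', a + b = m := by
    intro m hm
    obtain ⟨a, ha, b, hb, rfl⟩ := h m hm
    exact ⟨a, mem_filter.2 ⟨ha, by omega⟩, b, mem_filter.2 ⟨hb, by omega⟩, rfl⟩
  have h_card : #A' ≤ #A := card_filter_le _ _
  rcases le_or_gt 3 n with hn | hn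
  · have := basis_length_le_of_lt hn hA' h'
    nlinarith
  · have := sq_card_upper_half_add_le hA' h'
    rcases Nat.lt_or_ge #A 2 with h_lt | h_ge
    · nlinarith
    · nlinarith

theorem moser_upper_bound (k : ℕ) (hk : 0 < k) :
    (nAdd k : ℝ) ≤ (1 / 2 - 1 / 98) * (k : ℝ) ^ 2 + k ∧
    (nAdd k : ℝ) ≤ (24 / 49) * (k : ℝ) ^ 2 + k := by
  have h_nat : nAdd k ≤ (48 * k ^ 2 + 98 * k) / 98 := by
    refine csSup_le' ?_
    rintro n ⟨A, rfl, h⟩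
    rw [Nat.le_div_iff_mul_le (by norm_num), mul_comm]
    exact basis_length_le hk h
  rw [Nat.le_div_iff_mul_le (by norm_num)] at h_nat
  have h_real : (nAdd k * 98 : ℝ) ≤ 48 * (k : ℝ) ^ 2 + 98 * k := by exact_mod_cast h_nat
  constructor <;> linarith
end

section
/- Let κ, κ₀ ≥ 3 and τ, τ₀ ≥ 2 be real numbers. Let ξ_{κ,τ} and ξ_{κ₀,τ₀} be the respective positive roots of κξ² + τξ − 1 = 0 and κ₀ξ² + τ₀ξ − 1 = 0, and set ρ = ξ_{κ,τ}² and ρ₀ = ξ_{κ₀,τ₀}². Then |ρ − ρ₀| ≤ (1/54)|κ − κ₀| + (1/18)|τ − τ₀|. -/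
theorem root_le_one_third {κ τ ξ : ℝ} (hκ : 3 ≤ κ) (hτ : 2 ≤ τ) (hξpos : 0 < ξ)
    (hξ : κ * ξ ^ 2 + τ * ξ - 1 = 0) : ξ ≤ 1 / 3 := by
  by_contra! h
  nlinarith [mul_nonneg (sub_nonneg.2 hκ) (sq_nonneg ξ),
    mul_nonneg (sub_nonneg.2 hτ) hξpos.le]

theorem root_variation (κ κ₀ τ τ₀ ξ ξ₀ : ℝ)
    (hκ : 3 ≤ κ) (hκ₀ : 3 ≤ κ₀) (hτ : 2 ≤ τ) (hτ₀ : 2 ≤ τ₀)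
    (hξpos : 0 < ξ) (hξ : κ * ξ ^ 2 + τ * ξ - 1 = 0)
    (hξ₀pos : 0 < ξ₀) (hξ₀ : κ₀ * ξ₀ ^ 2 + τ₀ * ξ₀ - 1 = 0) :
    |ξ ^ 2 - ξ₀ ^ 2| ≤ (1 / 54) * |κ - κ₀| + (1 / 18) * |τ - τ₀| := by
  have hξ_le := root_le_one_third hκ hτ hξpos hξ
  have hξ₀_le := root_le_one_third hκ₀ hτ₀ hξ₀pos hξ₀
  have hsum : 0 < ξ + ξ₀ := by positivity
  have hden : 6 * (ξ + ξ₀) ≤ κ₀ * (ξ + ξ₀) + τ₀ := by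
    nlinarith [mul_nonneg (sub_nonneg.2 hκ₀) hsum.le]
  have hden_pos : 0 < κ₀ * (ξ + ξ₀) + τ₀ := by linarith
  have hdiff : (ξ ^ 2 - ξ₀ ^ 2) * (κ₀ * (ξ + ξ₀) + τ₀) =
      -((ξ + ξ₀) * ((κ - κ₀) * ξ ^ 2 + (τ - τ₀) * ξ)) := by
    linear_combination (ξ + ξ₀) * (hξ - hξ₀)
  have hnum : |(κ - κ₀) * ξ ^ 2 + (τ - τ₀) * ξ| ≤
      |κ - κ₀| * (1 / 9) + |τ - τ₀| * (1 / 3) := by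
    refine (abs_add_le _ _).trans ?_
    rw [abs_mul, abs_mul, abs_of_pos hξpos, abs_of_pos (pow_pos hξpos 2)]
    gcongr
    nlinarith
  refine le_of_mul_le_mul_right ?_ hden_pos
  calc |ξ ^ 2 - ξ₀ ^ 2| * (κ₀ * (ξ + ξ₀) + τ₀)
      = (ξ + ξ₀) * |(κ - κ₀) * ξ ^ 2 + (τ - τ₀) * ξ| := by
        rw [← abs_of_pos hden_pos, ← abs_mul, hdiff, abs_neg, abs_mul,
          abs_of_pos hsum]
    _ ≤ (κ₀ * (ξ + ξ₀) + τ₀) / 6 * (|κ - κ₀| * (1 / 9) + |τ - τ₀| * (1 / 3)) := by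
        gcongr
        linarith
    _ = ((1 / 54) * |κ - κ₀| + (1 / 18) * |τ - τ₀|) * (κ₀ * (ξ + ξ₀) + τ₀) := by ring
end

section
/- For every integer N ≥ 1, Σ_{R=N+1}^{∞} Σ_{(r₁,r₂) ∈ ℤ², max(|r₁|,|r₂|) = R, r₁ ≠ 0, r₂ ≠ 0, r₁ ≠ r₂} 1/(|r₁r₂|(r₁ − r₂)²) < 4(π²/3 + 1) · (1/N). -/
open scoped Real

/-- The harmonic sum `1 + 1/2 + ⋯ + 1/n` is at most `(n + 1) / 2`. -/
lemma two_mul_sum_Ico_one_div_le (n : ℕ) :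
    2 * ∑ k ∈ Finset.Ico 1 (n + 1), (1 : ℝ) / k ≤ n + 1 := by
  induction n with
  | zero => simp
  | succ n ih =>
    rw [Finset.sum_Ico_succ_top (by omega)]
    rcases Nat.eq_zero_or_pos n with rfl | hn
    · norm_num
    · have h : (1 : ℝ) / ((n + 1 : ℕ) : ℝ) ≤ 1 / 2 := by
        apply one_div_le_one_div_of_le (by norm_num)
        exact_mod_cast Nat.succ_le_succ hn
      push_cast at h ⊢
      linarith

lemma sum_one_div_sq_le (s : Finset ℕ) : ∑ k ∈ s, (1 : ℝ) / (k : ℝ) ^ 2 ≤ π ^ 2 / 6 :=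
  sum_le_hasSum s (fun _ _ => by positivity) hasSum_zeta_two

lemma sum_Ico_pos_side_le (R : ℕ) (hR : 1 ≤ R) :
    ∑ k ∈ Finset.Ico 1 R, (1 : ℝ) / (R * k * ((R : ℝ) - k) ^ 2) ≤ (π ^ 2 / 6 + 1) / R ^ 2 := by
  have hR0 : (0 : ℝ) < R := by exact_mod_cast hR
  have refl : ∀ f : ℕ → ℝ, ∑ k ∈ Finset.Ico 1 R, f (R - k) = ∑ k ∈ Finset.Ico 1 R, f k := by
    intro f
    refine Finset.sum_nbij' (fun k => R - k) (fun k => R - k) ?_ ?_ ?_ ?_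
      (fun _ _ => rfl) <;>
      intro k hk <;> simp only [Finset.mem_Ico] at hk ⊢ <;> omega
  have harm := two_mul_sum_Ico_one_div_le (R - 1)
  rw [Nat.sub_add_cancel hR, Nat.cast_sub hR] at harm
  push_cast at harm
  have hsq := sum_one_div_sq_le (Finset.Ico 1 R)
  have key : ∑ k ∈ Finset.Ico 1 R, (1 : ℝ) / (R * k * ((R : ℝ) - k) ^ 2) =
      ∑ k ∈ Finset.Ico 1 R, (1 / (R : ℝ) ^ 2 * (1 / ((R - k : ℕ) : ℝ) ^ 2)
        + 1 / (R : ℝ) ^ 3 * (1 / (k : ℝ) + 1 / ((R - k : ℕ) : ℝ))) := by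
    refine Finset.sum_congr rfl fun k hk => ?_
    rw [Finset.mem_Ico] at hk
    rw [Nat.cast_sub hk.2.le]
    have h1 : (k : ℝ) ≠ 0 := by exact_mod_cast (by omega : k ≠ 0)
    have h2 : (R : ℝ) - k ≠ 0 := sub_ne_zero.2 (by exact_mod_cast hk.2.ne')
    field_simp
    ring
  rw [key, Finset.sum_add_distrib, ← Finset.mul_sum, ← Finset.mul_sum, Finset.sum_add_distrib,
    refl (fun k => 1 / (k : ℝ) ^ 2), refl (fun k => 1 / (k : ℝ))]
  have e : (π ^ 2 / 6 + 1) / (R : ℝ) ^ 2 = 1 / (R : ℝ) ^ 2 * (π ^ 2 / 6) + 1 / (R : ℝ) ^ 3 * R := by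
    field_simp
  rw [e]
  gcongr
  linarith

lemma sum_Icc_neg_side_le (R : ℕ) (hR : 1 ≤ R) :
    ∑ k ∈ Finset.Icc 1 R, (1 : ℝ) / (R * k * ((R : ℝ) + k) ^ 2) ≤ (π ^ 2 / 6) / R ^ 2 := by
  have hR0 : (0 : ℝ) < R := by exact_mod_cast hR
  calc _ ≤ ∑ k ∈ Finset.Icc 1 R, 1 / (R : ℝ) ^ 2 * (1 / (k : ℝ) ^ 2) := by
        refine Finset.sum_le_sum fun k hk => ?_
        have hk0 : (0 : ℝ) < k := by exact_mod_cast (Finset.mem_Icc.1 hk).1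
        rw [one_div_mul_one_div]
        apply one_div_le_one_div_of_le (by positivity)
        have : (R : ℝ) * k ≤ (R + k) ^ 2 := by nlinarith
        calc (R : ℝ) ^ 2 * k ^ 2 = R * k * (R * k) := by ring
          _ ≤ _ := by gcongr
    _ ≤ 1 / (R : ℝ) ^ 2 * (π ^ 2 / 6) := by
        rw [← Finset.mul_sum]
        gcongr
        exact sum_one_div_sq_le _
    _ = _ := by ring

lemma sum_le_sum_add_sum_of_subset_image {ι κ : Type*} [DecidableEq κ] {s : Finset κ}
    {t u : Finset ι} {g h : ι → κ} {f : κ → ℝ} (hf : ∀ x, 0 ≤ f x)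
    (hs : s ⊆ t.image g ∪ u.image h) :
    ∑ x ∈ s, f x ≤ ∑ i ∈ t, f (g i) + ∑ i ∈ u, f (h i) := by
  have himage : ∀ (t : Finset ι) (g : ι → κ), ∑ x ∈ t.image g, f x ≤ ∑ i ∈ t, f (g i) :=
    fun t g => Finset.sum_image_le_of_nonneg fun i _ => hf _
  have hunion := Finset.sum_union_inter (s₁ := t.image g) (s₂ := u.image h) (f := f)
  have hinter : 0 ≤ ∑ x ∈ t.image g ∩ u.image h, f x := Finset.sum_nonneg fun i _ => hf i
  have := Finset.sum_le_sum_of_subset_of_nonneg hs fun i _ _ => hf i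
  linarith [himage t g, himage u h]

/-- The sum over one side of the square of radius `R`. -/
lemma sum_side_le (R : ℕ) (hR : 1 ≤ R) :
    ∑ k ∈ (Finset.Icc (-(R : ℤ)) R).filter (fun k : ℤ => k ≠ 0 ∧ k ≠ R),
      (1 : ℝ) / (|(R : ℝ) * k| * ((R : ℝ) - k) ^ 2) ≤ (π ^ 2 / 3 + 1) / R ^ 2 := by
  have hsub : (Finset.Icc (-(R : ℤ)) R).filter (fun k : ℤ => k ≠ 0 ∧ k ≠ R) ⊆
      (Finset.Ico 1 R).image (fun k : ℕ => (k : ℤ)) ∪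
        (Finset.Icc 1 R).image (fun k : ℕ => -(k : ℤ)) := by
    intro k
    simp only [Finset.mem_filter, Finset.mem_Icc, Finset.mem_union, Finset.mem_image,
      Finset.mem_Ico]
    rintro ⟨⟨h1, h2⟩, h3, h4⟩
    rcases lt_or_gt_of_ne h3 with h | h
    · exact Or.inr ⟨k.natAbs, by omega, by omega⟩
    · exact Or.inl ⟨k.natAbs, by omega, by omega⟩
  refine (sum_le_sum_add_sum_of_subset_image (fun k => by positivity) hsub).trans ?_
  have e : (π ^ 2 / 3 + 1) / (R : ℝ) ^ 2 =
      (π ^ 2 / 6 + 1) / (R : ℝ) ^ 2 + (π ^ 2 / 6) / (R : ℝ) ^ 2 := by ring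
  rw [e]
  refine add_le_add (le_of_eq_of_le ?_ (sum_Ico_pos_side_le R hR))
    (le_of_eq_of_le ?_ (sum_Icc_neg_side_le R hR))
  · refine Finset.sum_congr rfl fun k _ => ?_
    rw [Int.cast_natCast, abs_of_nonneg (by positivity)]
  · refine Finset.sum_congr rfl fun k _ => ?_
    rw [Int.cast_neg, Int.cast_natCast, mul_neg, abs_neg, abs_of_nonneg (by positivity),
      sub_neg_eq_add]

/-- The sum over the boundary of the square of radius `R`. -/
lemma sum_square_shell_le (R : ℕ) (hR : 1 ≤ R) :
    ∑ p ∈ (Finset.Icc (-(R : ℤ)) (R : ℤ) ×ˢ Finset.Icc (-(R : ℤ)) (R : ℤ)).filter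
        (fun p => max |p.1| |p.2| = (R : ℤ) ∧ p.1 ≠ 0 ∧ p.2 ≠ 0 ∧ p.1 ≠ p.2),
      (1 : ℝ) / (|(p.1 : ℝ) * (p.2 : ℝ)| * ((p.1 : ℝ) - (p.2 : ℝ)) ^ 2)
      ≤ 4 * (π ^ 2 / 3 + 1) / R ^ 2 := by
  set A := (Finset.Icc (-(R : ℤ)) R).filter (fun k : ℤ => k ≠ 0 ∧ k ≠ R) with hA
  have hsub : (Finset.Icc (-(R : ℤ)) (R : ℤ) ×ˢ Finset.Icc (-(R : ℤ)) (R : ℤ)).filter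
      (fun p => max |p.1| |p.2| = (R : ℤ) ∧ p.1 ≠ 0 ∧ p.2 ≠ 0 ∧ p.1 ≠ p.2) ⊆
      (({1, -1} : Finset ℤ) ×ˢ A).image (fun q => (q.1 * R, q.1 * q.2)) ∪
        (({1, -1} : Finset ℤ) ×ˢ A).image (fun q => (q.1 * q.2, q.1 * R)) := by
    rintro ⟨x, y⟩
    simp only [hA, Finset.mem_filter, Finset.mem_Icc, Finset.mem_union, Finset.mem_image,
      Finset.mem_product, Finset.mem_insert, Finset.mem_singleton, Prod.exists, Prod.mk.injEq]
    rintro ⟨⟨⟨h1, h2⟩, h3, h4⟩, h5, h6, h7, h8⟩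
    have hcases : (x = R ∨ x = -R) ∨ (y = R ∨ y = -R) := by
      rcases max_choice |x| |y| with h | h <;> rw [h] at h5
      · exact Or.inl (eq_or_eq_neg_of_abs_eq h5)
      · exact Or.inr (eq_or_eq_neg_of_abs_eq h5)
    rcases hcases with (h | h) | (h | h)
    · exact Or.inl ⟨1, y, by omega, by omega, by omega⟩
    · exact Or.inl ⟨-1, -y, by omega, by omega, by omega⟩
    · exact Or.inr ⟨1, x, by omega, by omega, by omega⟩
    · exact Or.inr ⟨-1, -x, by omega, by omega, by omega⟩
  refine (sum_le_sum_add_sum_of_subset_image (fun p => by positivity) hsub).trans ?_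
  have hside := sum_side_le R hR
  rw [← hA] at hside
  rw [Finset.sum_product, Finset.sum_product, Finset.sum_pair (by norm_num),
    Finset.sum_pair (by norm_num)]
  have e : 4 * (π ^ 2 / 3 + 1) / (R : ℝ) ^ 2 =
      ((π ^ 2 / 3 + 1) / (R : ℝ) ^ 2 + (π ^ 2 / 3 + 1) / (R : ℝ) ^ 2) +
        ((π ^ 2 / 3 + 1) / (R : ℝ) ^ 2 + (π ^ 2 / 3 + 1) / (R : ℝ) ^ 2) := by ring
  rw [e]
  refine add_le_add (add_le_add ?_ ?_) (add_le_add ?_ ?_) <;>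
    refine le_of_eq_of_le (Finset.sum_congr rfl fun k _ => ?_) hside <;>
    push_cast <;> congr 2 <;> ring_nf

lemma sum_range_telescope (N n : ℕ) :
    ∑ R ∈ Finset.range (n + 1), (if N + 1 ≤ R then 1 / ((R : ℝ) - 1) - 1 / (R : ℝ) else 0) =
      1 / (N : ℝ) - 1 / ((max N n : ℕ) : ℝ) := by
  induction n with
  | zero => simp
  | succ n ih =>
    rw [Finset.sum_range_succ, ih]
    split_ifs with h
    · rw [max_eq_right (by omega : N ≤ n), max_eq_right (by omega : N ≤ n + 1)]
      push_cast
      ring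
    · rw [max_eq_left (by omega : n ≤ N), max_eq_left (by omega : n + 1 ≤ N), add_zero]

theorem square_shell_sum_bound' (N : ℕ) (hN : 1 ≤ N) :
    (∑' R : ℕ, if N + 1 ≤ R then
        ∑ p ∈ (Finset.Icc (-(R : ℤ)) (R : ℤ) ×ˢ Finset.Icc (-(R : ℤ)) (R : ℤ)).filter
            (fun p => max |p.1| |p.2| = (R : ℤ) ∧ p.1 ≠ 0 ∧ p.2 ≠ 0 ∧ p.1 ≠ p.2),
          (1 : ℝ) / (|(p.1 : ℝ) * (p.2 : ℝ)| * ((p.1 : ℝ) - (p.2 : ℝ)) ^ 2)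
      else 0)
      < 4 * (π ^ 2 / 3 + 1) * (1 / (N : ℝ)) := by
  set g : ℕ → ℝ := fun R => if N + 1 ≤ R then 1 / ((R : ℝ) - 1) - 1 / (R : ℝ) else 0 with hg
  have hlt : ∀ R : ℕ, N + 1 ≤ R → 1 / (R : ℝ) ^ 2 < 1 / ((R : ℝ) - 1) - 1 / (R : ℝ) := by
    intro R hR
    have h2 : (2 : ℝ) ≤ R := by exact_mod_cast (by omega : 2 ≤ R)
    have h1 : (0 : ℝ) < R - 1 := by linarith
    have e : 1 / ((R : ℝ) - 1) - 1 / (R : ℝ) = 1 / ((R - 1) * R) := by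
      field_simp
      ring
    rw [e]
    exact one_div_lt_one_div_of_lt (by positivity) (by nlinarith)
  have hg0 : ∀ R, 0 ≤ g R := by
    intro R
    simp only [hg]
    split_ifs with h
    · exact le_trans (by positivity) (hlt R h).le
    · exact le_rfl
  have hpartial : ∀ n, ∑ R ∈ Finset.range n, g R ≤ 1 / (N : ℝ) := by
    intro n
    calc _ ≤ ∑ R ∈ Finset.range (n + 1), g R := by
          rw [Finset.sum_range_succ]
          linarith [hg0 n]
      _ = 1 / (N : ℝ) - 1 / ((max N n : ℕ) : ℝ) := sum_range_telescope N n
      _ ≤ _ := sub_le_self _ (by positivity)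
  have hgs : Summable g := summable_of_sum_range_le hg0 hpartial
  have hC : (0 : ℝ) < 4 * (π ^ 2 / 3 + 1) := by positivity
  have hbound : ∀ R : ℕ, N + 1 ≤ R →
      4 * (π ^ 2 / 3 + 1) / (R : ℝ) ^ 2 < 4 * (π ^ 2 / 3 + 1) * g R := by
    intro R hR
    simp only [hg, if_pos hR]
    rw [div_eq_mul_one_div]
    exact mul_lt_mul_of_pos_left (hlt R hR) hC
  have hCg := hgs.mul_left (4 * (π ^ 2 / 3 + 1))
  have hle : ∀ R : ℕ, (if N + 1 ≤ R then
        ∑ p ∈ (Finset.Icc (-(R : ℤ)) (R : ℤ) ×ˢ Finset.Icc (-(R : ℤ)) (R : ℤ)).filter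
            (fun p => max |p.1| |p.2| = (R : ℤ) ∧ p.1 ≠ 0 ∧ p.2 ≠ 0 ∧ p.1 ≠ p.2),
          (1 : ℝ) / (|(p.1 : ℝ) * (p.2 : ℝ)| * ((p.1 : ℝ) - (p.2 : ℝ)) ^ 2)
      else 0) ≤ 4 * (π ^ 2 / 3 + 1) * g R := by
    intro R
    split_ifs with h
    · exact (sum_square_shell_le R (by omega)).trans (hbound R h).le
    · exact mul_nonneg hC.le (hg0 R)
  refine lt_of_lt_of_le (Summable.tsum_lt_tsum (i := N + 1) hle ?_ ?_ hCg) ?_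
  · rw [if_pos le_rfl]
    exact (sum_square_shell_le (N + 1) (by omega)).trans_lt (hbound (N + 1) le_rfl)
  · refine Summable.of_nonneg_of_le (fun R => ?_) hle hCg
    split_ifs
    · exact Finset.sum_nonneg fun p _ => by positivity
    · exact le_rfl
  · rw [tsum_mul_left]
    exact mul_le_mul_of_nonneg_left (Real.tsum_le_of_sum_range_le hg0 hpartial) hC.le
end

section
/- The infimum of 1 − 40(1−t₁)(1−t₂)(1 − (2−t₁−t₂)⁶) over all (t₁,t₂) ∈ [0,1) × [0,1) with t₁ + t₂ ≥ 1 equals 1 − 15/2^{5/3}. In particular, 1 − 40(1−t₁)(1−t₂)(1 − (2−t₁−t₂)⁶) ≥ 1 − 15/2^{5/3} for all such (t₁,t₂). -/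
/-- The constant `15 / 2 ^ (5 / 3)` is `15 / 2 * c` for the positive cube root `c` of `1 / 4`. -/
lemma exists_cube_root_quarter :
    ∃ c : ℝ, 0 < c ∧ c ^ 3 = 1 / 4 ∧ 15 / (2 : ℝ) ^ ((5 : ℝ) / 3) = 15 / 2 * c := by
  have h2 : (0 : ℝ) < 2 := two_pos
  refine ⟨(2 : ℝ) ^ (-(2 : ℝ) / 3), by positivity, ?_, ?_⟩
  · rw [← Real.rpow_natCast, ← Real.rpow_mul h2.le]
    have h : -(2 : ℝ) / 3 * ((3 : ℕ) : ℝ) = -((2 : ℕ) : ℝ) := by norm_num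
    rw [h, Real.rpow_neg h2.le, Real.rpow_natCast]
    norm_num
  · have h : (2 : ℝ) ^ (-(2 : ℝ) / 3) * (2 : ℝ) ^ ((5 : ℝ) / 3) = 2 := by
      rw [← Real.rpow_add h2]
      norm_num
    rw [div_eq_iff (by positivity), mul_assoc, h]
    norm_num

/-- The tangent-line bound for `u * (1 - u ^ 3)` at its maximizer `c`. -/
lemma mul_one_sub_cube_le {c u : ℝ} (hc : 0 < c) (hc3 : c ^ 3 = 1 / 4) (hu : 0 ≤ u) :
    u * (1 - u ^ 3) ≤ 3 / 4 * c := by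
  have h : 0 ≤ (u - c) ^ 2 * (u ^ 2 + 2 * c * u + 3 * c ^ 2) := by positivity
  linear_combination h - (4 * u - 3 * c) * hc3

lemma mul_mul_one_sub_add_pow_le {a b c : ℝ} (ha : 0 ≤ a) (hb : 0 ≤ b) (hab : a + b ≤ 1)
    (hc : 0 < c) (hc3 : c ^ 3 = 1 / 4) :
    40 * a * b * (1 - (a + b) ^ 6) ≤ 15 / 2 * c := by
  have hs : 0 ≤ 1 - (a + b) ^ 6 := sub_nonneg.2 (pow_le_one₀ (add_nonneg ha hb) hab)
  have hu := mul_one_sub_cube_le hc hc3 (sq_nonneg (a + b))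
  have h := mul_nonneg (sq_nonneg (a - b)) hs
  linear_combination 10 * hu + 10 * h

theorem inf_on_R2 :
    sInf {x : ℝ | ∃ t₁ t₂ : ℝ, 0 ≤ t₁ ∧ t₁ < 1 ∧ 0 ≤ t₂ ∧ t₂ < 1 ∧ 1 ≤ t₁ + t₂ ∧
        x = 1 - 40 * (1 - t₁) * (1 - t₂) * (1 - (2 - t₁ - t₂) ^ 6)}
      = 1 - 15 / (2 : ℝ) ^ ((5 : ℝ) / 3) ∧
    ∀ t₁ t₂ : ℝ, 0 ≤ t₁ → t₁ < 1 → 0 ≤ t₂ → t₂ < 1 → 1 ≤ t₁ + t₂ →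
      1 - 15 / (2 : ℝ) ^ ((5 : ℝ) / 3)
        ≤ 1 - 40 * (1 - t₁) * (1 - t₂) * (1 - (2 - t₁ - t₂) ^ 6) := by
  obtain ⟨c, hc, hc3, hconst⟩ := exists_cube_root_quarter
  rw [hconst]
  have bound : ∀ t₁ t₂ : ℝ, 0 ≤ t₁ → t₁ < 1 → 0 ≤ t₂ → t₂ < 1 → 1 ≤ t₁ + t₂ →
      1 - 15 / 2 * c ≤ 1 - 40 * (1 - t₁) * (1 - t₂) * (1 - (2 - t₁ - t₂) ^ 6) := by
    intro t₁ t₂ _ h₁ _ h₂ h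
    have key := mul_mul_one_sub_add_pow_le (a := 1 - t₁) (b := 1 - t₂)
      (by linarith) (by linarith) (by linarith) hc hc3
    rw [show 1 - t₁ + (1 - t₂) = 2 - t₁ - t₂ by ring] at key
    linarith
  refine ⟨IsLeast.csInf_eq ⟨?_, ?_⟩, bound⟩
  · have hc1 : c ≤ 1 := by
      by_contra! h
      linarith [one_lt_pow₀ h three_ne_zero]
    have hs : 0 < √c := Real.sqrt_pos.2 hc
    have hs1 : √c ≤ 1 := Real.sqrt_le_one.2 hc1
    have hsq : √c ^ 2 = c := Real.sq_sqrt hc.le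
    refine ⟨1 - √c / 2, 1 - √c / 2, by linarith, by linarith, by linarith, by linarith,
      by linarith, ?_⟩
    have h6 : (2 - (1 - √c / 2) - (1 - √c / 2)) ^ 6 = 1 / 4 := by
      calc _ = (√c ^ 2) ^ 3 := by ring
        _ = 1 / 4 := by rw [hsq, hc3]
    rw [h6]
    linear_combination (15 / 2) * hsq
  · rintro x ⟨t₁, t₂, h₁, h₁', h₂, h₂', h, rfl⟩
    exact bound t₁ t₂ h₁ h₁' h₂ h₂' h
end
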